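/- arXiv:2007.12366 — 3 statements merged into one kernel-verified Lean document; each statement's English description precedes it below -/
import Mathlib

section
/- Let K ≥ 1, let F : [0,1]^K → [0,∞) be an increasing Borel combining function, and let ε ∈ (0,1). Then a_F(ε) = inf{ q_1(F(V_1,…,V_K)) : V_1,…,V_K random variables each uniformly distributed on [0,ε], with arbitrary joint dependence }, where q_1(X) = inf{x ∈ ℝ : P(X ≤ x) ≥ 1} is the essential supremum of X. -/
open MeasureTheory ProbabilityTheory Real Set Filter

/-- The uniform probability measure on `[0,1]` (Lebesgue measure restricted to `[0,1]`). -/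
noncomputable def unif01 : MeasureTheory.Measure ℝ :=
  MeasureTheory.volume.restrict (Set.Icc (0:ℝ) 1)

instance : MeasureTheory.IsProbabilityMeasure unif01 := by
  constructor
  simp [unif01, Real.volume_Icc]

/-- `U` is uniformly distributed on `[0,1]` under `P`. -/
def IsUnif {Ω : Type*} [MeasurableSpace Ω] (P : MeasureTheory.Measure Ω) (U : Ω → ℝ) : Prop :=
  Measurable U ∧ MeasureTheory.Measure.map U P = unif01

/-- Left `ε`-quantile of a random variable `X` under `P`:
`q_ε(X) = inf {x : ε ≤ P(X ≤ x)}`. -/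
noncomputable def lQuantile {Ω : Type*} [MeasurableSpace Ω] (P : MeasureTheory.Measure Ω)
    (X : Ω → ℝ) (ε : ℝ) : ℝ :=
  sInf {x : ℝ | ε ≤ (P {ω | X ω ≤ x}).toReal}

/-- The measure `P` is atomless: every non-null measurable set has a measurable subset of
different, nonzero measure. -/
def Atomless {Ω : Type*} [MeasurableSpace Ω] (P : MeasureTheory.Measure Ω) : Prop :=
  ∀ A, MeasurableSet A → P A ≠ 0 →
    ∃ B, B ⊆ A ∧ MeasurableSet B ∧ P B ≠ 0 ∧ P B ≠ P A

/-- VAD threshold: infimum of left `ε`-quantiles of `F(U_1,…,U_K)` over all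
uniformly distributed `U_1,…,U_K` on `[0,1]` with arbitrary joint dependence. -/
noncomputable def VAD {Ω : Type*} [MeasurableSpace Ω] (P : MeasureTheory.Measure Ω) (K : ℕ)
    (F : (Fin K → ℝ) → ℝ) (ε : ℝ) : ℝ :=
  sInf {y : ℝ | ∃ U : Fin K → Ω → ℝ, (∀ i, IsUnif P (U i)) ∧
    y = lQuantile P (fun ω => F (fun i => U i ω)) ε}

/-- VI threshold: left `ε`-quantile of `F(V_1,…,V_K)` for independent uniforms,
realized via the product measure. -/
noncomputable def VI (K : ℕ) (F : (Fin K → ℝ) → ℝ) (ε : ℝ) : ℝ :=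
  lQuantile (MeasureTheory.Measure.pi fun _ : Fin K => unif01) F ε

/-- VC threshold: left `ε`-quantile of `F(U,…,U)` for a single uniform `U`. -/
noncomputable def VC (K : ℕ) (F : (Fin K → ℝ) → ℝ) (ε : ℝ) : ℝ :=
  lQuantile unif01 (fun u => F (fun _ => u)) ε

/-- The uniform probability measure on `[0, b]`. -/
noncomputable def unifIcc0 (b : ℝ) : MeasureTheory.Measure ℝ :=
  (ENNReal.ofReal b)⁻¹ • MeasureTheory.volume.restrict (Set.Icc (0:ℝ) b)

/-- An atomless probability measure carries a real random variable whose law charges no point. -/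
theorem Atomless.exists_measurable_preimage_singleton_eq_zero
    {Ω : Type*} [MeasurableSpace Ω] {P : Measure Ω} [IsProbabilityMeasure P] (hP : Atomless P) :
    ∃ W : Ω → ℝ, Measurable W ∧ ∀ x, P (W ⁻¹' {x}) = 0 := by
  -- Minimise the probability that two independent copies of `W` coincide.
  let ψ : (Ω → ℝ) → ENNReal := fun W => (P.prod P) {p | W p.1 = W p.2}
  have hmin : ∃ W : Ω → ℝ, Measurable W ∧ ∀ W' : Ω → ℝ, Measurable W' → ψ W ≤ ψ W' := by
    have hne : (ψ '' {W | Measurable W}).Nonempty := ⟨_, fun _ => 0, measurable_const, rfl⟩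
    obtain ⟨u, -, hu, huS⟩ := exists_seq_tendsto_sInf hne (OrderBot.bddBelow _)
    choose w hw hwu using huS
    have he := measurableEmbedding_embeddingReal (ℕ → ℝ)
    refine ⟨fun ω => embeddingReal (ℕ → ℝ) fun n => w n ω,
      he.measurable.comp (measurable_pi_lambda _ hw), fun W' hW' => ?_⟩
    refine le_trans ?_ (sInf_le ((show ψ W' ∈ ψ '' {W | Measurable W} from ⟨W', hW', rfl⟩)))
    refine ge_of_tendsto' hu fun n => ?_
    rw [← hwu n]
    refine measure_mono fun p hp => ?_
    exact congrFun (he.injective hp) n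
  obtain ⟨W, hW, hmin⟩ := hmin
  refine ⟨W, hW, fun x => by_contra fun hx => ?_⟩
  have hA : MeasurableSet (W ⁻¹' {x}) := hW (measurableSet_singleton x)
  obtain ⟨B, hBA, hB, hB0, hBne⟩ := hP _ hA hx
  have hdiff : P (W ⁻¹' {x} \ B) ≠ 0 := by
    intro h0
    apply hBne
    rw [← measure_inter_add_sdiff (W ⁻¹' {x}) hB, h0, add_zero, inter_eq_self_of_subset_right hBA]
  have he := measurableEmbedding_embeddingReal (ℝ × ℝ)
  let W' : Ω → ℝ := fun ω => embeddingReal (ℝ × ℝ) (W ω, B.indicator 1 ω)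
  have hW' : Measurable W' :=
    he.measurable.comp (hW.prodMk (measurable_one.indicator hB))
  have hsub : {p : Ω × Ω | W' p.1 = W' p.2} ∪ B ×ˢ (W ⁻¹' {x} \ B) ⊆
      {p | W p.1 = W p.2} := by
    rintro ⟨a, b⟩ (h | ⟨ha, hb, -⟩)
    · exact congrArg Prod.fst (he.injective h)
    · exact (hBA ha).trans hb.symm
  have hdisj : Disjoint {p : Ω × Ω | W' p.1 = W' p.2} (B ×ˢ (W ⁻¹' {x} \ B)) := by
    rw [Set.disjoint_left]
    rintro ⟨a, b⟩ h ⟨ha, -, hb⟩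
    have h2 := congrArg Prod.snd (he.injective h)
    simp only at ha hb h2
    rw [indicator_of_mem ha, indicator_of_notMem hb] at h2
    exact one_ne_zero h2
  have hle : ψ W' + P B * P (W ⁻¹' {x} \ B) ≤ ψ W' := by
    refine le_trans ?_ (hmin W' hW')
    rw [← Measure.prod_prod, ← measure_union hdisj (hB.prod (hA.diff hB))]
    exact measure_mono hsub
  have hzero : P B * P (W ⁻¹' {x} \ B) = 0 := by
    by_contra h
    exact absurd hle (not_le.2 (ENNReal.lt_add_right (measure_ne_top _ _) h))
  exact (mul_ne_zero hB0 hdiff) hzero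

/-- The cdf of a probability measure without atoms is continuous. -/
theorem continuous_cdf_of_measure_singleton_eq_zero (μ : Measure ℝ) [IsProbabilityMeasure μ]
    (hμ : ∀ x, μ {x} = 0) : Continuous (cdf μ) := by
  rw [continuous_iff_continuousAt]
  intro x
  rw [(monotone_cdf μ).continuousAt_iff_leftLim_eq_rightLim, StieltjesFunction.rightLim_eq]
  have h := (cdf μ).measure_singleton x
  rw [measure_cdf, hμ, eq_comm, ENNReal.ofReal_eq_zero, sub_nonpos] at h
  exact le_antisymm ((monotone_cdf μ).leftLim_le le_rfl) h

theorem unif01_Iic (x : ℝ) : unif01 (Iic x) = ENNReal.ofReal (min 1 x) := by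
  rw [unif01, Measure.restrict_apply measurableSet_Iic, show Iic x ∩ Icc 0 1 = Icc 0 (min 1 x) by
    ext; simp only [mem_inter_iff, mem_Iic, mem_Icc, le_min_iff]; tauto,
    Real.volume_Icc, sub_zero]

/-- Probability integral transform. -/
theorem map_cdf_eq_unif01 (μ : Measure ℝ) [IsProbabilityMeasure μ]
    (hμ : ∀ x, μ {x} = 0) : μ.map (cdf μ) = unif01 := by
  have hc := continuous_cdf_of_measure_singleton_eq_zero μ hμ
  have hmeas : Measurable (cdf μ) := hc.measurable
  have : IsProbabilityMeasure (μ.map (cdf μ)) :=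
    Measure.isProbabilityMeasure_map hmeas.aemeasurable
  have hex : ∀ x ∈ Ioo (0 : ℝ) 1, ∃ t, cdf μ t = x := fun x hx =>
    mem_range_of_exists_le_of_exists_ge hc
      (((tendsto_cdf_atBot μ).eventually (ge_mem_nhds hx.1)).exists)
      (((tendsto_cdf_atTop μ).eventually (le_mem_nhds hx.2)).exists)
  have hlow : ∀ x ∈ Ioo (0 : ℝ) 1, ENNReal.ofReal x ≤ μ.map (cdf μ) (Iic x) := by
    intro x hx
    obtain ⟨t, rfl⟩ := hex x hx
    rw [ofReal_cdf, Measure.map_apply hmeas measurableSet_Iic]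
    exact measure_mono fun s hs => monotone_cdf μ hs
  have hupp : ∀ x ∈ Ico (0 : ℝ) 1, μ.map (cdf μ) (Iic x) ≤ ENNReal.ofReal x := by
    intro x hx
    have ht : Tendsto (fun y => ENNReal.ofReal y) (nhdsWithin x (Ioi x))
        (nhds (ENNReal.ofReal x)) :=
      (ENNReal.continuous_ofReal.tendsto x).mono_left nhdsWithin_le_nhds
    refine ge_of_tendsto ht ?_
    filter_upwards [Ioo_mem_nhdsGT hx.2] with y hy
    obtain ⟨t, rfl⟩ := hex y ⟨hx.1.trans_lt hy.1, hy.2⟩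
    rw [ofReal_cdf, Measure.map_apply hmeas measurableSet_Iic]
    refine measure_mono fun s hs => ?_
    by_contra hst
    exact absurd (hy.1.trans_le (monotone_cdf μ (not_le.1 hst).le)) (not_lt.2 hs)
  refine Measure.ext_of_Iic _ _ fun x => ?_
  rw [unif01_Iic]
  rcases lt_or_ge x 0 with h0 | h0
  · rw [ENNReal.ofReal_of_nonpos (min_le_of_right_le h0.le),
      Measure.map_apply hmeas measurableSet_Iic]
    convert measure_empty (μ := μ)
    ext s
    simpa using h0.trans_le (cdf_nonneg μ s)
  rcases le_or_gt 1 x with h1 | h1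
  · rw [min_eq_left h1, ENNReal.ofReal_one, Measure.map_apply hmeas measurableSet_Iic]
    convert measure_univ (μ := μ)
    ext s
    simpa using (cdf_le_one μ s).trans h1
  rw [min_eq_right h1.le]
  refine le_antisymm (hupp x ⟨h0, h1⟩) ?_
  rcases h0.eq_or_lt with rfl | h0
  · simp
  · exact hlow x ⟨h0, h1⟩

/-- Every Borel law is the law of a random variable on a given atomless probability space. -/
theorem Atomless.exists_map_eq {Ω : Type*} [MeasurableSpace Ω] {P : Measure Ω}
    [IsProbabilityMeasure P] (hP : Atomless P) {Y : Type*} [MeasurableSpace Y]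
    [StandardBorelSpace Y] (μ : Measure Y) [IsProbabilityMeasure μ] :
    ∃ Z : Ω → Y, Measurable Z ∧ P.map Z = μ := by
  obtain ⟨W, hW, hW0⟩ := hP.exists_measurable_preimage_singleton_eq_zero
  have : IsProbabilityMeasure (P.map W) := Measure.isProbabilityMeasure_map hW.aemeasurable
  have hnull : ∀ x, P.map W {x} = 0 := fun x => by
    rw [Measure.map_apply hW (measurableSet_singleton x), hW0]
  have hG : Measurable (cdf (P.map W)) := (monotone_cdf _).measurable
  have hI := map_cdf_eq_unif01 (P.map W) hnull
  have hnonempty : Nonempty Y := by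
    by_contra h
    rw [not_nonempty_iff] at h
    exact IsProbabilityMeasure.ne_zero μ (Measure.eq_zero_of_isEmpty μ)
  obtain ⟨f, hf, hfμ⟩ := μ.exists_measurable_map_eq
  let G : ℝ → unitInterval := fun t => ⟨cdf (P.map W) t, cdf_nonneg _ t, cdf_le_one _ t⟩
  have hGm : Measurable G := hG.subtype_mk
  refine ⟨f ∘ G ∘ W, hf.comp (hGm.comp hW), ?_⟩
  rw [← Measure.map_map hf (hGm.comp hW), ← Measure.map_map hGm hW, ← hfμ]
  congr 1
  have he := unitInterval.measurableEmbedding_coe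
  have hmap : ((P.map W).map G).map Subtype.val = (volume : Measure unitInterval).map Subtype.val := by
    rw [Measure.map_map he.measurable hGm, unitInterval.measurePreserving_coe.map_eq]
    exact hI
  rw [← he.comap_map ((P.map W).map G), hmap, he.comap_map]

/-- The scaled uniform law. -/
theorem map_const_mul_unif01 {ε : ℝ} (hε : 0 < ε) :
    unif01.map (fun x => ε * x) = unifIcc0 ε := by
  have hm : Measurable fun x : ℝ => ε * x := measurable_const_mul ε
  refine Measure.ext fun s hs => ?_
  rw [Measure.map_apply hm hs, unif01, Measure.restrict_apply (hm hs), unifIcc0,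
    Measure.smul_apply, Measure.restrict_apply hs, smul_eq_mul]
  have hI : Icc (0 : ℝ) 1 = (fun x => ε * x) ⁻¹' Icc 0 ε := by
    ext x
    simp only [mem_Icc, mem_preimage]
    constructor
    · rintro ⟨h0, h1⟩; constructor <;> nlinarith
    · rintro ⟨h0, h1⟩; constructor <;> nlinarith
  rw [hI, ← preimage_inter, Real.volume_preimage_mul_left hε.ne', abs_of_pos (inv_pos.2 hε),
    ENNReal.ofReal_inv_of_pos hε]

/-- A sublevel set of probability at least `δ` bounds the left `δ`-quantile of a nonnegative
random variable. -/
theorem lQuantile_le_of_le_measure {Ω : Type*} [MeasurableSpace Ω] {P : Measure Ω} {X : Ω → ℝ}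
    (hX : ∀ᵐ ω ∂P, 0 ≤ X ω) {δ y : ℝ} (hδ : 0 < δ) (hy : δ ≤ (P {ω | X ω ≤ y}).toReal) :
    lQuantile P X δ ≤ y ∧ 0 ≤ lQuantile P X δ := by
  have h0 : ∀ x ∈ {x : ℝ | δ ≤ (P {ω | X ω ≤ x}).toReal}, 0 ≤ x := by
    intro x hx
    by_contra hneg
    have : P {ω | X ω ≤ x} = 0 := by
      refine measure_mono_null ?_ hX
      intro ω (hω : X ω ≤ x) (h : 0 ≤ X ω)
      exact hneg (h.trans hω)
    simp only [mem_ofPred_eq, this, ENNReal.toReal_zero] at hx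
    exact absurd hδ (not_lt.2 hx)
  exact ⟨csInf_le ⟨0, h0⟩ hy, Real.sInf_nonneg h0⟩

/-- Random variables uniform on `[0,ε]` are coupled with uniform ones on `[0,1]` that have the same
joint law on an event of probability `ε`. -/
theorem exists_isUnif_of_unifIcc0 {Ω ι : Type*} [MeasurableSpace Ω] [Countable ι] {P : Measure Ω}
    [IsProbabilityMeasure P] (hP : Atomless P) {ε : ℝ} (hε0 : 0 < ε) (hε1 : ε < 1)
    {V : ι → Ω → ℝ} (hV : ∀ i, Measurable (V i)) (hVlaw : ∀ i, P.map (V i) = unifIcc0 ε) :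
    ∃ U : ι → Ω → ℝ, (∀ i, IsUnif P (U i)) ∧ ∀ S : Set (ι → ℝ), MeasurableSet S →
      ENNReal.ofReal ε * P {ω | (fun i => V i ω) ∈ S} ≤ P {ω | (fun i => U i ω) ∈ S} := by
  have hVm : Measurable fun ω i => V i ω := measurable_pi_lambda _ hV
  have hdiag : Measurable fun (x : ℝ) (_ : ι) => x := measurable_pi_lambda _ fun _ => measurable_id
  let ν : Measure (ι → ℝ) := ENNReal.ofReal ε • P.map (fun ω i => V i ω) +
    (volume.restrict (Ioc ε 1)).map (fun x _ => x)
  have hν : IsProbabilityMeasure ν := by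
    constructor
    simp only [ν, Measure.add_apply, Measure.smul_apply, Measure.map_apply hVm MeasurableSet.univ,
      Measure.map_apply hdiag MeasurableSet.univ, preimage_univ, measure_univ, smul_eq_mul, mul_one,
      Measure.restrict_apply_univ, Real.volume_Ioc]
    rw [← ENNReal.ofReal_add hε0.le (sub_nonneg.2 hε1.le)]
    simp
  obtain ⟨Z, hZ, hZν⟩ := hP.exists_map_eq ν
  refine ⟨fun i ω => Z ω i, fun i => ⟨(measurable_pi_apply i).comp hZ, ?_⟩, fun S hS => ?_⟩
  · have h1 : P.map (fun ω => Z ω i) = ν.map (fun z => z i) := by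
      rw [← hZν, Measure.map_map (measurable_pi_apply i) hZ]; rfl
    have h2 : ENNReal.ofReal ε • unifIcc0 ε = volume.restrict (Icc 0 ε) := by
      rw [unifIcc0, smul_smul, ENNReal.mul_inv_cancel (ENNReal.ofReal_pos.2 hε0).ne'
        ENNReal.ofReal_ne_top, one_smul]
    have h3 : Icc (0 : ℝ) 1 = Icc 0 ε ∪ Ioc ε 1 := (Icc_union_Ioc_eq_Icc hε0.le hε1.le).symm
    have h4 : Disjoint (Icc (0 : ℝ) ε) (Ioc ε 1) :=
      Set.disjoint_left.2 fun x hx hx' => absurd hx'.1 (not_lt.2 hx.2)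
    rw [h1, Measure.map_add _ _ (measurable_pi_apply i), Measure.map_smul,
      Measure.map_map (measurable_pi_apply i) hVm, Measure.map_map (measurable_pi_apply i) hdiag,
      unif01, h3, Measure.restrict_union h4 measurableSet_Ioc, ← h2, ← hVlaw i]
    congr 1
    exact Measure.map_id
  · have h1 : P {ω | (fun i => Z ω i) ∈ S} = ν S := by
      rw [← hZν, Measure.map_apply hZ hS]; rfl
    rw [h1, Measure.add_apply, Measure.smul_apply, Measure.map_apply hVm hS]
    exact le_self_add

/-- If uniform random variables on `[0,1]` lie in a decreasing set with probability at least `ε`,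
then some random variables uniform on `[0,ε]` lie in it almost surely. -/
theorem exists_unifIcc0_of_isUnif {Ω ι : Type*} [MeasurableSpace Ω] [Countable ι] {P : Measure Ω}
    [IsProbabilityMeasure P] (hP : Atomless P) {ε : ℝ} (hε0 : 0 < ε)
    {U : ι → Ω → ℝ} (hU : ∀ i, IsUnif P (U i)) {S : Set (ι → ℝ)} (hS : MeasurableSet S)
    (hSlower : ∀ p q : ι → ℝ, (∀ i, p i ∈ Icc (0 : ℝ) 1) → (∀ i, q i ∈ Icc (0 : ℝ) 1) →
      p ≤ q → q ∈ S → p ∈ S)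
    (hUS : ENNReal.ofReal ε ≤ P {ω | (fun i => U i ω) ∈ S}) :
    ∃ V : ι → Ω → ℝ, (∀ i, Measurable (V i) ∧ P.map (V i) = unifIcc0 ε) ∧
      P {ω | (fun i => V i ω) ∈ S} = 1 := by
  have hUm : Measurable fun ω i => U i ω := measurable_pi_lambda _ fun i => (hU i).1
  set A : Set Ω := {ω | (fun i => U i ω) ∈ S} with hAdef
  have hA : MeasurableSet A := hUm hS
  have hεpos : 0 < ENNReal.ofReal ε := ENNReal.ofReal_pos.2 hε0
  have hA0 : P A ≠ 0 := (hεpos.trans_le hUS).ne'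
  let Q : Measure Ω := ProbabilityTheory.cond P A
  have hQ : IsProbabilityMeasure Q := cond_isProbabilityMeasure hA0
  have hQP : Q ≪ P := cond_absolutelyContinuous
  let μ : ι → Measure ℝ := fun i => Q.map (U i)
  have hμ : ∀ i, IsProbabilityMeasure (μ i) := fun i =>
    Measure.isProbabilityMeasure_map (hU i).1.aemeasurable
  have hμ0 : ∀ i x, μ i {x} = 0 := fun i x => by
    rw [Measure.map_apply (hU i).1 (measurableSet_singleton x)]
    apply hQP
    rw [← Measure.map_apply (hU i).1 (measurableSet_singleton x), (hU i).2, unif01]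
    exact measure_singleton x
  have hcdf : ∀ i, ∀ x ∈ Icc (0 : ℝ) 1, ε * cdf (μ i) x ≤ x := by
    intro i x hx
    have h1 : ENNReal.ofReal ε * ENNReal.ofReal (cdf (μ i) x) ≤ ENNReal.ofReal x := by
      rw [ofReal_cdf, Measure.map_apply (hU i).1 measurableSet_Iic, cond_apply hA]
      calc ENNReal.ofReal ε * ((P A)⁻¹ * P (A ∩ U i ⁻¹' Iic x))
          ≤ P A * ((P A)⁻¹ * P (U i ⁻¹' Iic x)) := by gcongr; exact inter_subset_right
        _ = unif01 (Iic x) := by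
            rw [← mul_assoc, ENNReal.mul_inv_cancel hA0 (measure_ne_top _ _), one_mul, ← (hU i).2,
              Measure.map_apply (hU i).1 measurableSet_Iic]
        _ = ENNReal.ofReal x := by rw [unif01_Iic, min_eq_right hx.2]
    rw [← ENNReal.ofReal_mul hε0.le] at h1
    exact (ENNReal.ofReal_le_ofReal_iff hx.1).1 h1
  have hTm : ∀ i, Measurable fun ω => ε * cdf (μ i) (U i ω) := fun i =>
    ((monotone_cdf (μ i)).measurable.comp (hU i).1).const_mul ε
  let T : Ω → ι → ℝ := fun ω i => ε * cdf (μ i) (U i ω)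
  have hT : Measurable T := measurable_pi_lambda _ hTm
  have hTlaw : ∀ i, Q.map (fun ω => T ω i) = unifIcc0 ε := fun i => by
    rw [← map_const_mul_unif01 hε0, ← map_cdf_eq_unif01 (μ i) (hμ0 i),
      Measure.map_map (measurable_const_mul ε) (monotone_cdf (μ i)).measurable,
      Measure.map_map ((measurable_const_mul ε).comp (monotone_cdf (μ i)).measurable) (hU i).1]
    rfl
  have hTS : ∀ᵐ ω ∂Q, T ω ∈ S := by
    have hcube : ∀ᵐ ω ∂Q, ∀ i, U i ω ∈ Icc (0 : ℝ) 1 := by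
      refine ae_all_iff.2 fun i => hQP.ae_le ?_
      refine ae_of_ae_map (hU i).1.aemeasurable ?_
      rw [(hU i).2, unif01]
      exact ae_restrict_mem measurableSet_Icc
    filter_upwards [hcube, ae_cond_mem hA] with ω hω hωA
    refine hSlower _ _ (fun i => ⟨mul_nonneg hε0.le (cdf_nonneg _ _), ?_⟩) hω
      (fun i => hcdf i _ (hω i)) hωA
    exact (hcdf i _ (hω i)).trans (hω i).2
  have : IsProbabilityMeasure (Q.map T) := Measure.isProbabilityMeasure_map hT.aemeasurable
  obtain ⟨Z, hZ, hZT⟩ := hP.exists_map_eq (Q.map T)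
  refine ⟨fun i ω => Z ω i, fun i => ⟨(measurable_pi_apply i).comp hZ, ?_⟩, ?_⟩
  · rw [← hTlaw i]
    have h1 := congrArg (Measure.map fun z : ι → ℝ => z i) hZT
    rw [Measure.map_map (measurable_pi_apply i) hZ,
      Measure.map_map (measurable_pi_apply i) hT] at h1
    exact h1
  · have h1 : P {ω | (fun i => Z ω i) ∈ S} = Q.map T S := by
      rw [← hZT, Measure.map_apply hZ hS]; rfl
    rw [h1, Measure.map_apply hT hS]
    exact (measure_congr (eventuallyEq_univ.2 hTS)).trans measure_univ

/-- the VAD threshold at level `ε` equals the infimum, over all tuples of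
random variables uniformly distributed on `[0,ε]` with arbitrary joint dependence, of the
essential supremum (left `1`-quantile) of `F(V_1,…,V_K)`. -/
theorem vad_eq_inf_essSup_unif_eps
    {Ω : Type*} [MeasurableSpace Ω] (P : MeasureTheory.Measure Ω)
    [MeasureTheory.IsProbabilityMeasure P] (hP : Atomless P)
    (K : ℕ) (hK : 1 ≤ K) (F : (Fin K → ℝ) → ℝ)
    (hFmeas : Measurable F)
    (hFnonneg : ∀ p : Fin K → ℝ, (∀ i, p i ∈ Set.Icc (0:ℝ) 1) → 0 ≤ F p)
    (hFmono : ∀ p q : Fin K → ℝ, (∀ i, p i ∈ Set.Icc (0:ℝ) 1) →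
      (∀ i, q i ∈ Set.Icc (0:ℝ) 1) → p ≤ q → F p ≤ F q)
    (ε : ℝ) (hε : ε ∈ Set.Ioo (0:ℝ) 1) :
    VAD P K F ε =
      sInf {y : ℝ | ∃ V : Fin K → Ω → ℝ,
        (∀ i, Measurable (V i) ∧ MeasureTheory.Measure.map (V i) P = unifIcc0 ε) ∧
        y = lQuantile P (fun ω => F (fun i => V i ω)) 1} := by
  obtain ⟨hε0, hε1⟩ := hε
  have hone : (fun _ => 1 : Fin K → ℝ) ∈ {p : Fin K → ℝ | ∀ i, p i ∈ Icc (0 : ℝ) 1} :=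
    fun _ => ⟨zero_le_one, le_rfl⟩
  have hSm : ∀ y, MeasurableSet {p | F p ≤ y} := fun y => hFmeas measurableSet_Iic
  have hcubeU : ∀ U : Fin K → Ω → ℝ, (∀ i, IsUnif P (U i)) →
      ∀ᵐ ω ∂P, ∀ i, U i ω ∈ Icc (0 : ℝ) 1 := by
    intro U hU
    refine ae_all_iff.2 fun i => ae_of_ae_map (hU i).1.aemeasurable ?_
    rw [(hU i).2, unif01]
    exact ae_restrict_mem measurableSet_Icc
  have hcubeV : ∀ V : Fin K → Ω → ℝ,
      (∀ i, Measurable (V i) ∧ Measure.map (V i) P = unifIcc0 ε) →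
      ∀ᵐ ω ∂P, ∀ i, V i ω ∈ Icc (0 : ℝ) 1 := by
    intro V hV
    refine ae_all_iff.2 fun i => ae_of_ae_map (hV i).1.aemeasurable ?_
    rw [(hV i).2, unifIcc0]
    refine Measure.ae_smul_measure ?_ _
    filter_upwards [ae_restrict_mem measurableSet_Icc] with x hx
    exact ⟨hx.1, hx.2.trans hε1.le⟩
  -- A random vector in the cube lies below `F 1` almost surely.
  have htop : ∀ X : Fin K → Ω → ℝ, (∀ᵐ ω ∂P, ∀ i, X i ω ∈ Icc (0 : ℝ) 1) →
      (P {ω | F (fun i => X i ω) ≤ F fun _ => 1}).toReal = 1 := by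
    intro X hX
    have : P {ω | F (fun i => X i ω) ≤ F fun _ => 1} = 1 := by
      refine (measure_congr (eventuallyEq_univ.2 ?_)).trans measure_univ
      filter_upwards [hX] with ω hω
      exact hFmono _ _ hω hone fun i => (hω i).2
    rw [this, ENNReal.toReal_one]
  have hpos : ∀ X : Fin K → Ω → ℝ, (∀ᵐ ω ∂P, ∀ i, X i ω ∈ Icc (0 : ℝ) 1) →
      ∀ᵐ ω ∂P, 0 ≤ F (fun i => X i ω) := by
    intro X hX
    filter_upwards [hX] with ω hω using hFnonneg _ hω
  have hlevel : ∀ (X : Fin K → Ω → ℝ) (δ y : ℝ), (∀ᵐ ω ∂P, ∀ i, X i ω ∈ Icc (0 : ℝ) 1) → δ ≤ 1 →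
      lQuantile P (fun ω => F (fun i => X i ω)) δ < y →
      δ ≤ (P {ω | F (fun i => X i ω) ≤ y}).toReal := by
    intro X δ y hX hδ hy
    obtain ⟨x, hx, hxy⟩ := exists_lt_of_csInf_lt
      (s := {x : ℝ | δ ≤ (P {ω | F (fun i => X i ω) ≤ x}).toReal})
      ⟨F fun _ => 1, hδ.trans (htop X hX).ge⟩ hy
    refine le_trans hx (ENNReal.toReal_mono (measure_ne_top _ _) (measure_mono ?_))
    intro ω (hω : _ ≤ x)
    exact hω.trans hxy.le
  rw [VAD]
  refine le_antisymm ?_ ?_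
  · refine le_csInf ?_ ?_
    · have : IsProbabilityMeasure (unifIcc0 ε) := by
        rw [← map_const_mul_unif01 hε0]
        exact Measure.isProbabilityMeasure_map (measurable_const_mul ε).aemeasurable
      obtain ⟨W, hW, hWlaw⟩ := hP.exists_map_eq (unifIcc0 ε)
      exact ⟨_, fun _ => W, fun _ => ⟨hW, hWlaw⟩, rfl⟩
    · rintro _ ⟨V, hV, rfl⟩
      refine le_of_forall_gt_imp_ge_of_dense fun y hy => ?_
      have h1 := hlevel V 1 y (hcubeV V hV) le_rfl hy
      obtain ⟨U, hU, hUV⟩ := exists_isUnif_of_unifIcc0 hP hε0 hε1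
        (fun i => (hV i).1) fun i => (hV i).2
      have h2 := ENNReal.toReal_mono (measure_ne_top _ _) (hUV _ (hSm y))
      rw [ENNReal.toReal_mul, ENNReal.toReal_ofReal hε0.le] at h2
      have h3 := (le_mul_of_one_le_right hε0.le h1).trans h2
      refine csInf_le_of_le ⟨0, ?_⟩ ⟨U, hU, rfl⟩
        (lQuantile_le_of_le_measure (hpos U (hcubeU U hU)) hε0 h3).1
      rintro _ ⟨U', hU', rfl⟩
      exact (lQuantile_le_of_le_measure (hpos U' (hcubeU U' hU')) hε0
        (hε1.le.trans (htop U' (hcubeU U' hU')).ge)).2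
  · refine le_csInf ?_ ?_
    · obtain ⟨W, hW, hWlaw⟩ := hP.exists_map_eq unif01
      exact ⟨_, fun _ => W, fun _ => ⟨hW, hWlaw⟩, rfl⟩
    · rintro _ ⟨U, hU, rfl⟩
      refine le_of_forall_gt_imp_ge_of_dense fun y hy => ?_
      have h1 := hlevel U ε y (hcubeU U hU) hε1.le hy
      obtain ⟨V, hV, hVy⟩ := exists_unifIcc0_of_isUnif hP hε0 hU (hSm y)
        (fun p q hp hq hpq hqS => (hFmono p q hp hq hpq).trans hqS)
        ((ENNReal.ofReal_le_iff_le_toReal (measure_ne_top _ _)).2 h1)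
      have h2 : (1 : ℝ) ≤ (P {ω | F (fun i => V i ω) ≤ y}).toReal :=
        (congrArg ENNReal.toReal hVy).ge
      refine csInf_le_of_le ⟨0, ?_⟩ ⟨V, hV, rfl⟩
        (lQuantile_le_of_le_measure (hpos V (hcubeV V hV)) one_pos h2).1
      rintro _ ⟨V', hV', rfl⟩
      exact (lQuantile_le_of_le_measure (hpos V' (hcubeV V' hV')) one_pos
        (htop V' (hcubeV V' hV')).ge).2
end

section
/- Let K ≥ 2 and α = (α_1,…,α_K) with 0 ≤ α_1 ≤ ⋯ ≤ α_K and α_K > 0, and define S_{α,K}(p_1,…,p_K) = min_{1≤i≤K} p_{(i)}/α_i (with p_{(i)}/0 = +∞), where p_{(1)} ≤ ⋯ ≤ p_{(K)} are the order statistics. Then S_{α,K} is IC-balanced, i.e. S_{α,K}(V_1,…,V_K) has the same distribution as S_{α,K}(U,…,U) for independent uniform V_1,…,V_K and uniform U on [0,1], if and only if there exists c > 0 such that α_i = c·i for all i = 1,…,K (i.e., S_{α,K} is a positive constant times the Simes function). -/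
open MeasureTheory ProbabilityTheory Real Set Filter

/-- The order-statistics combining function `S_{α,K}(p) = min_{i : α_i ≠ 0} p_{(i)}/α_i`
(with the convention `p_{(i)}/0 = +∞`, so that indices with `α_i = 0` do not contribute);
`p_{(i)} = p (Tuple.sort p i)` denotes the `(i+1)`-th smallest order statistic. -/
noncomputable def Sorder (K : ℕ) (α : Fin K → ℝ) (p : Fin K → ℝ) : ℝ :=
  sInf {y : ℝ | ∃ i : Fin K, α i ≠ 0 ∧ y = p (Tuple.sort p i) / α i}

/-- The number of coordinates of `p` that do not exceed `y`. -/
noncomputable def countLE {n : ℕ} (p : Fin n → ℝ) (y : ℝ) : ℕ :=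
  (Finset.univ.filter fun j => p j ≤ y).card

lemma countLE_le {n : ℕ} (p : Fin n → ℝ) (y : ℝ) : countLE p y ≤ n :=
  (Finset.card_filter_le _ _).trans (by simp)

lemma countLE_eq_of_forall_le {n : ℕ} {p : Fin n → ℝ} {y : ℝ} (h : ∀ j, p j ≤ y) :
    countLE p y = n := by
  simp [countLE, h]

lemma countLE_insertNth {n : ℕ} (j : Fin (n + 1)) (t : ℝ) (q : Fin n → ℝ) (y : ℝ) :
    countLE (j.insertNth t q : Fin (n + 1) → ℝ) y = (if t ≤ y then 1 else 0) + countLE q y := by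
  simp only [countLE, Finset.card_filter]
  rw [Fin.sum_univ_succAbove _ j]
  simp

lemma measurable_countLE {n : ℕ} (y : ℝ) : Measurable fun p : Fin n → ℝ => countLE p y := by
  simp only [countLE, Finset.card_filter]
  refine Finset.measurable_sum _ fun j _ => ?_
  exact Measurable.ite (measurableSet_le (measurable_pi_apply j) measurable_const)
    measurable_const measurable_const

/-- The points of `(0, T]ⁿ` whose order statistics satisfy `a i < p_{(i+1)}` for all `i < n`. -/
def orderRegion (a : ℕ → ℝ) (n : ℕ) (T : ℝ) : Set (Fin n → ℝ) :=
  {p | (∀ j, p j ∈ Ioc 0 T) ∧ ∀ i < n, countLE p (a i) ≤ i}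

lemma measurableSet_orderRegion (a : ℕ → ℝ) (n : ℕ) (T : ℝ) :
    MeasurableSet (orderRegion a n T) := by
  have h1 : MeasurableSet {p : Fin n → ℝ | ∀ j, p j ∈ Ioc 0 T} := by
    rw [ofPred_forall]
    exact MeasurableSet.iInter fun j => measurable_pi_apply j measurableSet_Ioc
  have h2 : MeasurableSet {p : Fin n → ℝ | ∀ i < n, countLE p (a i) ≤ i} := by
    simp only [ofPred_forall]
    exact MeasurableSet.iInter fun i => MeasurableSet.iInter fun _ =>
      measurable_countLE (a i) measurableSet_Iic
  exact h1.inter h2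

lemma insertNth_mem_orderRegion_iff {a : ℕ → ℝ} (ha : Monotone a) (ha0 : 0 ≤ a 0) {n : ℕ} {T : ℝ}
    (j : Fin (n + 1)) (t : ℝ) (q : Fin n → ℝ) :
    ((j.insertNth t q : Fin (n + 1) → ℝ) ∈ orderRegion a (n + 1) T ∧ ∀ i, q i ≤ t) ↔
      t ∈ Ioc (a n) T ∧ q ∈ orderRegion a n t := by
  simp only [orderRegion, mem_ofPred_eq, countLE_insertNth, j.forall_iff_succAbove,
    Fin.insertNth_apply_same, Fin.insertNth_apply_succAbove, mem_Ioc]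
  constructor
  · rintro ⟨⟨⟨⟨ht0, htT⟩, hq⟩, hc⟩, hqt⟩
    have hat : a n < t := by
      by_contra! hta
      have := hc n n.lt_succ_self
      rw [if_pos hta, countLE_eq_of_forall_le fun i => (hqt i).trans hta] at this
      omega
    refine ⟨⟨hat, htT⟩, fun i => ⟨(hq i).1, hqt i⟩, fun i hi => ?_⟩
    have := hc i (by omega)
    omega
  · rintro ⟨⟨hat, htT⟩, hq, hc⟩
    have h0 : 0 < t := (ha0.trans (ha n.zero_le)).trans_lt hat
    refine ⟨⟨⟨⟨h0, htT⟩, fun i => ⟨(hq i).1, (hq i).2.trans htT⟩⟩, fun i hi => ?_⟩,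
      fun i => (hq i).2⟩
    have : ¬ t ≤ a i := not_le.2 ((ha (Nat.lt_succ_iff.1 hi)).trans_lt hat)
    rw [if_neg this, zero_add]
    rcases (Nat.lt_succ_iff.1 hi).lt_or_eq with h | rfl
    · exact hc i h
    · exact countLE_le _ _

lemma volume_setOf_apply_eq_apply {n : ℕ} {i j : Fin n} (hij : i ≠ j) :
    volume {p : Fin n → ℝ | p i = p j} = 0 := by
  let φ : (Fin n → ℝ) →ₗ[ℝ] ℝ :=
    LinearMap.proj (R := ℝ) (φ := fun _ : Fin n => ℝ) i -
      LinearMap.proj (R := ℝ) (φ := fun _ : Fin n => ℝ) j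
  have : {p : Fin n → ℝ | p i = p j} = (LinearMap.ker φ : Set (Fin n → ℝ)) := by
    ext p
    simp [φ, sub_eq_zero]
  rw [this]
  refine Measure.addHaar_submodule _ _ fun h => ?_
  have h1 : φ (Pi.single i 1) = 0 := by
    rw [← LinearMap.mem_ker, h]
    trivial
  simp [φ, hij.symm] at h1

lemma volume_orderRegion_succ {a : ℕ → ℝ} (ha : Monotone a) (ha0 : 0 ≤ a 0) (n : ℕ) (T : ℝ) :
    volume (orderRegion a (n + 1) T) =
      (n + 1) * ∫⁻ t in Ioc (a n) T, volume (orderRegion a n t) := by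
  let B : Fin (n + 1) → Set (Fin (n + 1) → ℝ) := fun j =>
    {p | p ∈ orderRegion a (n + 1) T ∧ ∀ i, p i ≤ p j}
  have hBm : ∀ j, MeasurableSet (B j) := fun j => by
    have h : MeasurableSet {p : Fin (n + 1) → ℝ | ∀ i, p i ≤ p j} := by
      rw [ofPred_forall]
      exact MeasurableSet.iInter fun i =>
        measurableSet_le (measurable_pi_apply i) (measurable_pi_apply j)
    exact (measurableSet_orderRegion a (n + 1) T).inter h
  have hB : orderRegion a (n + 1) T = ⋃ j, B j := by
    ext p
    simp only [B, mem_iUnion, mem_ofPred_eq, exists_and_left]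
    refine ⟨fun h => ⟨h, Finite.exists_max p⟩, fun h => h.1⟩
  have hdisj : Pairwise (Function.onFun (AEDisjoint volume) B) := fun i j hij =>
    measure_mono_null (fun p hp => le_antisymm (hp.2.2 i) (hp.1.2 j))
      (volume_setOf_apply_eq_apply hij)
  have hvol : ∀ j, volume (B j) = ∫⁻ t in Ioc (a n) T, volume (orderRegion a n t) := fun j => by
    let e := MeasurableEquiv.piFinSuccAbove (fun _ : Fin (n + 1) => ℝ) j
    have hpre : B j = e ⁻¹' (e.symm ⁻¹' B j) := by
      ext p
      simp
    rw [hpre,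
      (volume_preserving_piFinSuccAbove (fun _ : Fin (n + 1) => ℝ) j).measure_preimage_equiv,
      Measure.volume_eq_prod, Measure.prod_apply (e.symm.measurable (hBm j)),
      ← lintegral_indicator measurableSet_Ioc]
    refine lintegral_congr fun t => ?_
    have hsec : Prod.mk t ⁻¹' (e.symm ⁻¹' B j) = {q | t ∈ Ioc (a n) T ∧ q ∈ orderRegion a n t} := by
      ext q
      rw [mem_ofPred_eq, ← insertNth_mem_orderRegion_iff ha ha0 j t q]
      change (_ ∧ ∀ i, (j.insertNth t q : Fin (n + 1) → ℝ) i ≤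
        (j.insertNth t q : Fin (n + 1) → ℝ) j) ↔ _
      refine and_congr_right fun _ => ?_
      rw [j.forall_iff_succAbove]
      simp
    rw [hsec]
    by_cases ht : t ∈ Ioc (a n) T
    · simp only [ht, true_and, ofPred_mem_eq, indicator_of_mem]
    · simp only [ht, false_and, ofPred_false, measure_empty, not_false_eq_true, indicator_of_notMem]
  rw [hB, measure_iUnion₀ hdisj fun j => (hBm j).nullMeasurableSet, tsum_fintype]
  simp [hvol]

/-- A sequence of iterated antiderivatives of the constant `1`, normalised to vanish successively at
the points of `a`, i.e. the Gončarov functions of `a`. -/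
structure IsGoncarov (a : ℕ → ℝ) (n : ℕ) (f : ℕ → ℝ → ℝ) : Prop where
  zero : ∀ t, f 0 t = 1
  hasDerivAt : ∀ k t, HasDerivAt (f (k + 1)) (f k t) t
  root : ∀ k < n, f (k + 1) (a k) = 0

namespace IsGoncarov

variable {a : ℕ → ℝ} {n : ℕ} {f : ℕ → ℝ → ℝ}

lemma continuous (hf : IsGoncarov a n f) : ∀ k, Continuous (f k)
  | 0 => by
    rw [funext hf.zero]
    exact continuous_const
  | k + 1 => continuous_iff_continuousAt.2 fun t => (hf.hasDerivAt k t).continuousAt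

lemma mono (hf : IsGoncarov a n f) {m : ℕ} (h : m ≤ n) : IsGoncarov a m f :=
  ⟨hf.zero, hf.hasDerivAt, fun k hk => hf.root k (hk.trans_le h)⟩

lemma integral_eq (hf : IsGoncarov a (n + 1) f) (T : ℝ) :
    ∫ t in a n..T, f n t = f (n + 1) T := by
  rw [intervalIntegral.integral_eq_sub_of_hasDerivAt (fun t _ => hf.hasDerivAt n t)
    ((hf.continuous n).intervalIntegrable _ _), hf.root n n.lt_succ_self, sub_zero]

lemma nonneg (ha : Monotone a) : ∀ {n : ℕ}, IsGoncarov a n f → ∀ {T : ℝ}, (∀ i < n, a i ≤ T) →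
    0 ≤ f n T
  | 0, hf, T, _ => by simp [hf.zero]
  | n + 1, hf, T, hT => by
    rw [← hf.integral_eq T]
    refine intervalIntegral.integral_nonneg (hT n n.lt_succ_self) fun t ht => ?_
    exact nonneg ha (hf.mono n.le_succ) fun i hi => (ha hi.le).trans ht.1

end IsGoncarov

lemma volume_orderRegion {a : ℕ → ℝ} (ha : Monotone a) (ha0 : 0 ≤ a 0) {f : ℕ → ℝ → ℝ} :
    ∀ {n : ℕ}, IsGoncarov a n f → ∀ {T : ℝ}, (∀ i < n, a i ≤ T) →
      volume (orderRegion a n T) = ENNReal.ofReal (n.factorial * f n T)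
  | 0, hf, T, _ => by
    have : orderRegion a 0 T = univ := by
      ext p
      simp [orderRegion]
    rw [this, hf.zero, volume_pi, Measure.pi_univ]
    simp
  | n + 1, hf, T, hT => by
    have hle : a n ≤ T := hT n n.lt_succ_self
    have hn := hf.mono n.le_succ
    have hcongr : ∫⁻ t in Ioc (a n) T, volume (orderRegion a n t) =
        ∫⁻ t in Ioc (a n) T, ENNReal.ofReal (n.factorial * f n t) :=
      setLIntegral_congr_fun measurableSet_Ioc fun t ht =>
        volume_orderRegion ha ha0 hn fun i hi => (ha hi.le).trans ht.1.le
    have hcont : Continuous fun t => (n.factorial : ℝ) * f n t :=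
      continuous_const.mul (hf.continuous n)
    rw [volume_orderRegion_succ ha ha0, hcongr, ← ofReal_integral_eq_lintegral_ofReal,
      ← intervalIntegral.integral_of_le hle, intervalIntegral.integral_const_mul, hf.integral_eq,
      Nat.factorial_succ]
    · have : ((n : ENNReal) + 1) = ENNReal.ofReal ((n : ℝ) + 1) := by
        rw [ENNReal.ofReal_add (by positivity) zero_le_one]
        simp
      rw [this, ← ENNReal.ofReal_mul (by positivity)]
      push_cast
      ring_nf
    · exact hcont.integrableOn_Ioc
    · refine (ae_restrict_iff' measurableSet_Ioc).2 (ae_of_all _ fun t ht => ?_)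
      exact mul_nonneg (by positivity)
        (IsGoncarov.nonneg ha hn fun i hi => (ha hi.le).trans ht.1.le)

namespace IsGoncarov

variable {a : ℕ → ℝ} {n : ℕ} {f : ℕ → ℝ → ℝ}

lemma scale (hf : IsGoncarov a n f) {x : ℝ} (hx : x ≠ 0) :
    IsGoncarov (fun k => x * a k) n fun k t => x ^ k * f k (t / x) where
  zero t := by simp [hf.zero]
  hasDerivAt k t := by
    have h := ((hf.hasDerivAt k (t / x)).comp t ((hasDerivAt_id t).div_const x)).const_mul
      (x ^ (k + 1))
    refine h.congr_deriv ?_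
    field_simp
    ring
  root k hk := by
    simp [mul_div_cancel_left₀ _ hx, hf.root k hk]

open Polynomial in
lemma of_polynomial {P : ℕ → ℝ[X]} (h0 : P 0 = 1) (hd : ∀ k, derivative (P (k + 1)) = P k)
    (hr : ∀ k < n, (P (k + 1)).eval (a k) = 0) : IsGoncarov a n fun k t => (P k).eval t where
  zero t := by simp [h0]
  hasDerivAt k t := by
    have := (P (k + 1)).hasDerivAt t
    rwa [hd] at this
  root := hr

end IsGoncarov

section Polynomial

open Polynomial

lemma exists_derivative_eq_and_eval_eq_zero (p : ℝ[X]) (x : ℝ) :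
    ∃ q : ℝ[X], derivative q = p ∧ q.eval x = 0 := by
  obtain ⟨q, hq⟩ : ∃ q : ℝ[X], derivative q = p := by
    induction p using Polynomial.induction_on' with
    | add p q hp hq =>
      obtain ⟨p', rfl⟩ := hp
      obtain ⟨q', rfl⟩ := hq
      exact ⟨p' + q', derivative_add⟩
    | monomial n c =>
      refine ⟨monomial (n + 1) (c / (n + 1)), ?_⟩
      rw [derivative_monomial]
      have : (n : ℝ) + 1 ≠ 0 := by positivity
      simp [div_mul_cancel₀ _ this]
  exact ⟨q - C (q.eval x), by simp [hq], by simp⟩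

lemma exists_goncarov_polynomials (a : ℕ → ℝ) :
    ∃ P : ℕ → ℝ[X], P 0 = 1 ∧ (∀ k, derivative (P (k + 1)) = P k) ∧
      ∀ k, (P (k + 1)).eval (a k) = 0 := by
  choose g hg hg0 using exists_derivative_eq_and_eval_eq_zero
  let P : ℕ → ℝ[X] := fun n => Nat.rec 1 (fun k p => g p (a k)) n
  exact ⟨P, rfl, fun k => hg (P k) (a k), fun k => hg0 (P k) (a k)⟩

/-- The Abel polynomials `X ^ (k - 1) * (X - k * c) / k!`. -/
noncomputable def abelPoly (c : ℝ) : ℕ → ℝ[X]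
  | 0 => 1
  | k + 1 => C ((k + 1).factorial : ℝ)⁻¹ * (X ^ k * (X - C ((k + 1) * c)))

lemma derivative_abelPoly (c : ℝ) : ∀ k, derivative (abelPoly c (k + 1)) = abelPoly c k
  | 0 => by simp [abelPoly]
  | k + 1 => by
    refine Polynomial.funext fun t => ?_
    have h1 : ((k : ℝ) + 1) ≠ 0 := by positivity
    have h2 : ((k : ℝ) + 1 + 1) ≠ 0 := by positivity
    have h3 : (k.factorial : ℝ) ≠ 0 := by positivity
    simp [abelPoly, Nat.factorial_succ, derivative_mul]
    field_simp
    ring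

lemma factorial_mul_eval_abelPoly (c : ℝ) (k : ℕ) (t : ℝ) :
    ((k + 1).factorial : ℝ) * (abelPoly c (k + 1)).eval t = t ^ k * (t - (k + 1) * c) := by
  have : ((k + 1).factorial : ℝ) ≠ 0 := by positivity
  simp [abelPoly, mul_inv_cancel_left₀ this]

lemma eq_of_eq_abelPoly {a : ℕ → ℝ} {P : ℕ → ℝ[X]} {c : ℝ} (ha : Monotone a) (hc : 0 < c)
    (hd : ∀ k, derivative (P (k + 1)) = P k) (hr : ∀ k, (P (k + 1)).eval (a k) = 0) {n : ℕ}
    (h : P n = abelPoly c n) {k : ℕ} (hk : k < n) : a k = c * (k + 1) := by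
  have hP : ∀ k ≤ n, P k = abelPoly c k := fun k hk => by
    induction hk using Nat.decreasingInduction with
    | self => exact h
    | of_succ k _ ih => rw [← hd, ih, derivative_abelPoly]
  have hroot : ∀ k < n, a k ^ k * (a k - (k + 1) * c) = 0 := fun k hk => by
    rw [← factorial_mul_eval_abelPoly, ← hP (k + 1) hk, hr, mul_zero]
  have h0 : a 0 = c := by
    have := hroot 0 (by omega)
    simp at this
    linarith
  have hpos : 0 < a k := (h0 ▸ hc).trans_le (ha k.zero_le)
  have := (mul_eq_zero.1 (hroot k hk)).resolve_left (by positivity)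
  linarith

end Polynomial

lemma lt_apply_sort_iff {n : ℕ} (p : Fin n → ℝ) (y : ℝ) (i : Fin n) :
    y < p (Tuple.sort p i) ↔ countLE p y ≤ i := by
  have h := Tuple.lt_card_le_iff_apply_le_of_monotone (j := i) (a := y) (Tuple.monotone_sort p)
  have hcard : (Finset.univ.filter fun j => (p ∘ Tuple.sort p) j ≤ y).card = countLE p y := by
    simp only [countLE, Finset.card_filter, Function.comp]
    exact Equiv.sum_comp (Tuple.sort p) fun j => if p j ≤ y then 1 else 0
  rw [hcard] at h
  rw [← not_lt (b := countLE p y), h, not_le, Function.comp]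

section OrderStatistics

variable {K : ℕ} {α : Fin K → ℝ}

lemma lt_Sorder_iff (hnonneg : ∀ i, 0 ≤ α i) (hne : ∃ i, α i ≠ 0) (p : Fin K → ℝ) (x : ℝ) :
    x < Sorder K α p ↔ ∀ i, α i ≠ 0 → countLE p (x * α i) ≤ i := by
  have hset : {y : ℝ | ∃ i : Fin K, α i ≠ 0 ∧ y = p (Tuple.sort p i) / α i} =
      (fun i => p (Tuple.sort p i) / α i) '' {i | α i ≠ 0} := by
    ext y
    simp [eq_comm]
  rw [Sorder, hset,
    Set.Finite.lt_csInf_iff ((toFinite {i | α i ≠ 0}).image _) (Set.Nonempty.image _ hne),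
    forall_mem_image]
  refine forall_congr' fun i => imp_congr_right fun hi => ?_
  rw [← lt_apply_sort_iff, lt_div_iff₀ ((hnonneg i).lt_of_ne' hi)]

lemma measurable_Sorder (hnonneg : ∀ i, 0 ≤ α i) (hne : ∃ i, α i ≠ 0) :
    Measurable (Sorder K α) := by
  refine measurable_of_Ioi fun x => ?_
  have : Sorder K α ⁻¹' Ioi x = ⋂ i, ⋂ (_ : α i ≠ 0), {p | countLE p (x * α i) ≤ i} := by
    ext p
    simp [lt_Sorder_iff hnonneg hne]
  rw [this]
  exact MeasurableSet.iInter fun i => MeasurableSet.iInter fun _ =>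
    measurable_countLE _ measurableSet_Iic

lemma lt_Sorder_of_nonpos (hnonneg : ∀ i, 0 ≤ α i) (hne : ∃ i, α i ≠ 0) {p : Fin K → ℝ}
    (hp : ∀ j, 0 < p j) {x : ℝ} (hx : x ≤ 0) : x < Sorder K α p := by
  rw [lt_Sorder_iff hnonneg hne]
  intro i _
  have : countLE p (x * α i) = 0 := by
    simp only [countLE, Finset.card_eq_zero, Finset.filter_eq_empty_iff, not_le]
    exact fun j _ => (mul_nonpos_of_nonpos_of_nonneg hx (hnonneg i)).trans_lt (hp j)
  omega

lemma unif01_eq_restrict_Ioc : unif01 = volume.restrict (Ioc (0 : ℝ) 1) :=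
  Measure.restrict_congr_set Ioc_ae_eq_Icc.symm

lemma pi_unif01_eq_restrict (K : ℕ) : (Measure.pi fun _ : Fin K => unif01) =
    volume.restrict {p | ∀ j, p j ∈ Ioc (0 : ℝ) 1} := by
  have : {p : Fin K → ℝ | ∀ j, p j ∈ Ioc (0 : ℝ) 1} = univ.pi fun _ => Ioc (0 : ℝ) 1 := by
    ext p
    simp
  rw [this, volume_pi, Measure.restrict_pi_pi]
  simp only [unif01_eq_restrict_Ioc]

/-- The sequence `k ↦ α k`, continued constantly beyond the last index. -/
def extendLast {n : ℕ} (α : Fin (n + 1) → ℝ) (k : ℕ) : ℝ :=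
  α ⟨min k n, by omega⟩

end OrderStatistics

section Law

variable {n : ℕ} {α : Fin (n + 1) → ℝ}

lemma extendLast_apply (i : Fin (n + 1)) : extendLast α i = α i := by
  unfold extendLast
  congr 1
  ext
  simp only
  omega

lemma monotone_extendLast (hmono : Monotone α) : Monotone (extendLast α) := fun _ _ hij =>
  hmono (Fin.mk_le_mk.2 (min_le_min_right n hij))

lemma inter_preimage_Sorder_eq_orderRegion (hnonneg : ∀ i, 0 ≤ α i) (hne : ∃ i, α i ≠ 0) (x : ℝ) :
    Sorder (n + 1) α ⁻¹' Ioi x ∩ {p | ∀ j, p j ∈ Ioc (0 : ℝ) 1} =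
      orderRegion (fun k => x * extendLast α k) (n + 1) 1 := by
  ext p
  simp only [orderRegion, mem_inter_iff, mem_preimage, mem_Ioi, mem_ofPred_eq,
    lt_Sorder_iff hnonneg hne]
  rw [and_comm]
  refine and_congr_right fun hp => ⟨fun h i hi => ?_, fun h i _ => ?_⟩
  · have hi' := extendLast_apply (α := α) ⟨i, hi⟩
    simp only at hi'
    rw [hi']
    by_cases h0 : α ⟨i, hi⟩ = 0
    · have : countLE p (x * α ⟨i, hi⟩) = 0 := by
        simp only [h0, mul_zero, countLE, Finset.card_eq_zero, Finset.filter_eq_empty_iff, not_le]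
        exact fun j _ => (hp j).1
      omega
    · exact h ⟨i, hi⟩ h0
  · simpa only [extendLast_apply] using h i i.2

lemma map_pi_Sorder_Ioi (hnonneg : ∀ i, 0 ≤ α i) (hne : ∃ i, α i ≠ 0) (x : ℝ) :
    (Measure.pi fun _ : Fin (n + 1) => unif01).map (fun p => Sorder (n + 1) α p) (Ioi x) =
      volume (orderRegion (fun k => x * extendLast α k) (n + 1) 1) := by
  have hS := measurable_Sorder hnonneg hne
  rw [Measure.map_apply hS measurableSet_Ioi, pi_unif01_eq_restrict,
    Measure.restrict_apply (hS measurableSet_Ioi),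
    inter_preimage_Sorder_eq_orderRegion hnonneg hne]

lemma map_pi_Sorder_Ioi_eq_ofReal (hnonneg : ∀ i, 0 ≤ α i) (hmono : Monotone α)
    (hlast : 0 < α (Fin.last n)) {f : ℕ → ℝ → ℝ} (hf : IsGoncarov (extendLast α) (n + 1) f)
    {x : ℝ} (hx : 0 < x) (hx1 : x * α (Fin.last n) ≤ 1) :
    (Measure.pi fun _ : Fin (n + 1) => unif01).map (fun p => Sorder (n + 1) α p) (Ioi x) =
      ENNReal.ofReal ((n + 1).factorial * (x ^ (n + 1) * f (n + 1) (1 / x))) := by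
  rw [map_pi_Sorder_Ioi hnonneg ⟨_, hlast.ne'⟩]
  refine volume_orderRegion (fun _ _ hij => ?_) ?_ (hf.scale hx.ne') fun i hi => ?_
  · exact mul_le_mul_of_nonneg_left (monotone_extendLast hmono hij) hx.le
  · exact mul_nonneg hx.le (hnonneg _)
  · exact (mul_le_mul_of_nonneg_left (hmono (Fin.le_last _)) hx.le).trans hx1

lemma map_pi_Sorder_Ioi_eq_zero (hnonneg : ∀ i, 0 ≤ α i) (hlast : 0 < α (Fin.last n)) {x : ℝ}
    (hx1 : 1 < x * α (Fin.last n)) :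
    (Measure.pi fun _ : Fin (n + 1) => unif01).map (fun p => Sorder (n + 1) α p) (Ioi x) = 0 := by
  rw [map_pi_Sorder_Ioi hnonneg ⟨_, hlast.ne'⟩]
  refine measure_mono_null (t := ∅) (fun p ⟨hp, hc⟩ => ?_) measure_empty
  have h1 : countLE p (x * extendLast α n) ≤ n := hc n n.lt_succ_self
  have h2 := extendLast_apply (α := α) (Fin.last n)
  simp only [Fin.val_last] at h2
  rw [h2, countLE_eq_of_forall_le fun j => (hp j).2.trans hx1.le] at h1
  omega

lemma measurable_Sorder_const (hnonneg : ∀ i, 0 ≤ α i) (hne : ∃ i, α i ≠ 0) :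
    Measurable fun u : ℝ => Sorder (n + 1) α fun _ => u :=
  (measurable_Sorder hnonneg hne).comp (measurable_pi_lambda _ fun _ => measurable_id)

lemma lt_Sorder_const_iff (hnonneg : ∀ i, 0 ≤ α i) (hmono : Monotone α)
    (hlast : 0 < α (Fin.last n)) {x : ℝ} (hx : 0 < x) (u : ℝ) :
    (x < Sorder (n + 1) α fun _ => u) ↔ x * α (Fin.last n) < u := by
  rw [lt_Sorder_iff hnonneg ⟨_, hlast.ne'⟩]
  refine ⟨fun h => ?_, fun h i _ => ?_⟩
  · by_contra! hu
    have := h (Fin.last n) hlast.ne'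
    rw [countLE_eq_of_forall_le fun _ => hu] at this
    simp at this
  · have : ¬ u ≤ x * α i :=
      not_le.2 ((mul_le_mul_of_nonneg_left (hmono (Fin.le_last i)) hx.le).trans_lt h)
    simp [countLE, this]

lemma map_unif01_Sorder_const_Ioi (hnonneg : ∀ i, 0 ≤ α i) (hmono : Monotone α)
    (hlast : 0 < α (Fin.last n)) {x : ℝ} (hx : 0 < x) :
    unif01.map (fun u => Sorder (n + 1) α fun _ => u) (Ioi x) =
      ENNReal.ofReal (1 - x * α (Fin.last n)) := by
  have hS := measurable_Sorder_const hnonneg ⟨_, hlast.ne'⟩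
  rw [Measure.map_apply hS measurableSet_Ioi, unif01_eq_restrict_Ioc,
    Measure.restrict_apply (hS measurableSet_Ioi), ← Real.volume_Ioc]
  congr 1
  ext u
  simp only [mem_inter_iff, mem_preimage, mem_Ioi, lt_Sorder_const_iff hnonneg hmono hlast hx,
    mem_Ioc]
  exact ⟨fun h => ⟨h.1, h.2.2⟩, fun h => ⟨h.1, (mul_pos hx hlast).trans h.1, h.2⟩⟩

lemma map_Sorder_eq_iff (hnonneg : ∀ i, 0 ≤ α i) (hmono : Monotone α)
    (hlast : 0 < α (Fin.last n)) {f : ℕ → ℝ → ℝ} (hf : IsGoncarov (extendLast α) (n + 1) f) :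
    (Measure.pi fun _ : Fin (n + 1) => unif01).map (fun p => Sorder (n + 1) α p) =
        unif01.map (fun u => Sorder (n + 1) α fun _ => u) ↔
      ∀ t, α (Fin.last n) ≤ t →
        (n + 1).factorial * f (n + 1) t = t ^ n * (t - α (Fin.last n)) := by
  have hne : ∃ i, α i ≠ 0 := ⟨_, hlast.ne'⟩
  have hS := measurable_Sorder hnonneg hne
  have hS' := measurable_Sorder_const hnonneg hne
  have hscale : ∀ x : ℝ, 0 < x → ((n + 1).factorial * (x ^ (n + 1) * f (n + 1) (1 / x)) =
      1 - x * α (Fin.last n) ↔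
      (n + 1).factorial * f (n + 1) (1 / x) = (1 / x) ^ n * (1 / x - α (Fin.last n))) := by
    intro x hx
    have : 1 - x * α (Fin.last n) = x ^ (n + 1) * ((1 / x) ^ n * (1 / x - α (Fin.last n))) := by
      rw [div_pow]
      field_simp
      ring
    rw [this, mul_left_comm, mul_right_inj' (by positivity)]
  constructor
  · intro h t ht
    have ht0 : 0 < t := hlast.trans_le ht
    have hx1 : 1 / t * α (Fin.last n) ≤ 1 := by
      rw [one_div_mul_eq_div]
      exact div_le_one_of_le₀ ht ht0.le
    have h1 := map_pi_Sorder_Ioi_eq_ofReal hnonneg hmono hlast hf (one_div_pos.2 ht0) hx1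
    rw [h, map_unif01_Sorder_const_Ioi hnonneg hmono hlast (one_div_pos.2 ht0),
      ENNReal.ofReal_eq_ofReal_iff (by linarith)] at h1
    · simpa using (hscale _ (one_div_pos.2 ht0)).1 h1.symm
    · have := IsGoncarov.nonneg (monotone_extendLast hmono) hf (T := t) fun i _ =>
        (hmono (Fin.le_last _)).trans ht
      rw [one_div_one_div]
      positivity
  · intro h
    have : IsProbabilityMeasure ((Measure.pi fun _ : Fin (n + 1) => unif01).map
        fun p => Sorder (n + 1) α p) := Measure.isProbabilityMeasure_map hS.aemeasurable
    have : IsProbabilityMeasure (unif01.map fun u => Sorder (n + 1) α fun _ => u) :=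
      Measure.isProbabilityMeasure_map hS'.aemeasurable
    refine Measure.ext_of_Iic _ _ fun x => ?_
    rw [← compl_Ioi, prob_compl_eq_one_sub measurableSet_Ioi,
      prob_compl_eq_one_sub measurableSet_Ioi]
    congr 1
    rcases le_or_gt x 0 with hx | hx
    · have h1 : ∀ᵐ p ∂(Measure.pi fun _ : Fin (n + 1) => unif01), x < Sorder (n + 1) α p := by
        rw [pi_unif01_eq_restrict]
        refine ae_restrict_of_forall_mem ?_ fun p hp =>
          lt_Sorder_of_nonpos hnonneg hne (fun j => (hp j).1) hx
        rw [ofPred_forall]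
        exact MeasurableSet.iInter fun j => measurable_pi_apply j measurableSet_Ioc
      have h2 : ∀ᵐ u ∂unif01, x < Sorder (n + 1) α fun _ => u := by
        rw [unif01_eq_restrict_Ioc]
        exact ae_restrict_of_forall_mem measurableSet_Ioc fun u hu =>
          lt_Sorder_of_nonpos hnonneg hne (fun _ => hu.1) hx
      rw [Measure.map_apply hS measurableSet_Ioi, Measure.map_apply hS' measurableSet_Ioi,
        mem_ae_iff_prob_eq_one (hS measurableSet_Ioi) |>.1 h1,
        mem_ae_iff_prob_eq_one (hS' measurableSet_Ioi) |>.1 h2]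
    · rw [map_unif01_Sorder_const_Ioi hnonneg hmono hlast hx]
      rcases le_or_gt (x * α (Fin.last n)) 1 with hx1 | hx1
      · rw [map_pi_Sorder_Ioi_eq_ofReal hnonneg hmono hlast hf hx hx1,
          (hscale x hx).2 (h _ ((le_div_iff₀' hx).2 hx1))]
      · rw [map_pi_Sorder_Ioi_eq_zero hnonneg hlast hx1, ENNReal.ofReal_of_nonpos (by linarith)]

end Law

/-- `S_{α,K}` is IC-balanced if and only if `α_i = c·i` for some `c > 0`,
i.e. `S_{α,K}` is a positive constant times the Simes function. -/
theorem icBalanced_order_statistics_iff_simes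
    (K : ℕ) (hK : 2 ≤ K) (α : Fin K → ℝ)
    (hnonneg : ∀ i, 0 ≤ α i) (hmono : Monotone α)
    (hpos : 0 < α ⟨K - 1, by omega⟩) :
    (MeasureTheory.Measure.map (fun p : Fin K → ℝ => Sorder K α p)
        (MeasureTheory.Measure.pi fun _ : Fin K => unif01)
      = MeasureTheory.Measure.map (fun u : ℝ => Sorder K α (fun _ => u)) unif01) ↔
    (∃ c : ℝ, 0 < c ∧ ∀ i : Fin K, α i = c * ((i : ℕ) + 1)) := by
  obtain ⟨n, rfl⟩ : ∃ n, K = n + 1 := ⟨K - 1, by omega⟩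
  have hlast : 0 < α (Fin.last n) := hpos
  have hlast' : extendLast α n = α (Fin.last n) := extendLast_apply (Fin.last n)
  constructor
  · intro h
    obtain ⟨P, h0, hd, hr⟩ := exists_goncarov_polynomials (extendLast α)
    have hP := (map_Sorder_eq_iff hnonneg hmono hlast
      (IsGoncarov.of_polynomial h0 hd fun k _ => hr k)).1 h
    have hc : 0 < α (Fin.last n) / (n + 1) := by positivity
    have hPn : P (n + 1) = abelPoly (α (Fin.last n) / (n + 1)) (n + 1) := by
      refine Polynomial.eq_of_infinite_eval_eq _ _
        ((Ici_infinite (α (Fin.last n))).mono fun t ht => ?_)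
      have hfac : ((n + 1).factorial : ℝ) ≠ 0 := by positivity
      refine mul_left_cancel₀ hfac ?_
      rw [hP t ht, factorial_mul_eval_abelPoly, mul_div_cancel₀ _ (by positivity)]
    refine ⟨_, hc, fun i => ?_⟩
    rw [← extendLast_apply (α := α) i]
    exact eq_of_eq_abelPoly (monotone_extendLast hmono) hc hd hr hPn i.2
  · rintro ⟨c, hc, hα⟩
    refine (map_Sorder_eq_iff hnonneg hmono hlast (IsGoncarov.of_polynomial (P := abelPoly c) rfl
      (derivative_abelPoly c) fun k hk => ?_)).2 fun t _ => ?_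
    · have : extendLast α k = c * (k + 1) := by
        rw [← hα ⟨k, hk⟩]
        exact extendLast_apply ⟨k, hk⟩
      rw [this]
      simp [abelPoly, mul_comm]
    · rw [factorial_mul_eval_abelPoly, hα, Fin.val_last, mul_comm c]
end

section
/- Fix K ≥ 2 and c ∈ (0,1). For every δ > 0 there exists η > 0 such that for all p_1,…,p_K ∈ (0,1) with min_{1≤i≤K} p_i < η and max_{1≤i≤K} p_i ≤ c, one has |M_{C,K}(p_1,…,p_K)/M_{−1,K}(p_1,…,p_K) − 1| < δ. In other words, M_{C,K}(p_1,…,p_K)/M_{−1,K}(p_1,…,p_K) → 1 as min_i p_i ↓ 0 subject to max_i p_i ≤ c. -/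
open MeasureTheory ProbabilityTheory Real Set Filter

/-- standard Cauchy quantile function `C⁻¹(p) = tan(π(p - 1/2))`. -/
noncomputable def cauchyQuantile (p : ℝ) : ℝ := Real.tan (π * (p - 1/2))

/-- standard Cauchy cdf `C(x) = arctan(x)/π + 1/2`. -/
noncomputable def cauchyCdf (x : ℝ) : ℝ := Real.arctan x / π + 1/2

/-- Cauchy combining function `M_{C,K}`. -/
noncomputable def MCauchy (K : ℕ) (p : Fin K → ℝ) : ℝ :=
  cauchyCdf ((∑ i, cauchyQuantile (p i)) / (K : ℝ))

/-- harmonic mean combining function `M_{-1,K}`. -/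
noncomputable def Mharm (K : ℕ) (p : Fin K → ℝ) : ℝ :=
  (K : ℝ) / (∑ i, (p i)⁻¹)

/-- The Cauchy quantile function is minus the cotangent of `π p`. -/
lemma cauchyQuantile_eq (p : ℝ) : cauchyQuantile p = -(cos (π * p) / sin (π * p)) := by
  have h : π * (p - 1 / 2) = -(π / 2 - π * p) := by ring
  rw [cauchyQuantile, h, Real.tan_neg, Real.tan_pi_div_two_sub, Real.tan_eq_sin_div_cos, inv_div]

lemma cos_div_sin_le_inv {t : ℝ} (h0 : 0 < t) (hπ : t < π) : cos t / sin t ≤ t⁻¹ := by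
  have hs := Real.sin_pos_of_pos_of_lt_pi h0 hπ
  rw [inv_eq_one_div, div_le_div_iff₀ hs h0, one_mul]
  rcases le_or_gt (π / 2) t with h | h
  · have := Real.cos_nonpos_of_pi_div_two_le_of_le h (by linarith)
    nlinarith
  · have hc := Real.cos_pos_of_mem_Ioo ⟨by linarith, h⟩
    have := Real.le_tan h0.le h
    rw [Real.tan_eq_sin_div_cos, le_div_iff₀ hc] at this
    linarith

lemma inv_le_cos_div_sin_add_tan_half {t : ℝ} (h0 : 0 < t) (hπ : t < π) :
    t⁻¹ ≤ cos t / sin t + tan (t / 2) := by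
  have hs := Real.sin_pos_of_pos_of_lt_pi h0 hπ
  have hs2 : 0 < sin (t / 2) := Real.sin_pos_of_pos_of_lt_pi (by linarith) (by linarith)
  have hc2 : 0 < cos (t / 2) := Real.cos_pos_of_mem_Ioo ⟨by linarith, by linarith⟩
  have key : cos t / sin t + tan (t / 2) = (sin t)⁻¹ := by
    have e : t = 2 * (t / 2) := by ring
    have h1 : sin t = 2 * sin (t / 2) * cos (t / 2) := by
      conv_lhs => rw [e, Real.sin_two_mul]
    have h2 : cos t = 2 * cos (t / 2) ^ 2 - 1 := by
      conv_lhs => rw [e, Real.cos_two_mul]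
    rw [h1, h2, Real.tan_eq_sin_div_cos]
    field_simp
    linarith [Real.sin_sq_add_cos_sq (t / 2)]
  rw [key]
  exact inv_anti₀ hs (Real.sin_le h0.le)

lemma neg_inv_le_cauchyQuantile {p : ℝ} (hp : p ∈ Set.Ioo (0 : ℝ) 1) :
    -(p⁻¹ / π) ≤ cauchyQuantile p := by
  have h := cos_div_sin_le_inv (mul_pos Real.pi_pos hp.1)
    (mul_lt_of_lt_one_right Real.pi_pos hp.2)
  rw [cauchyQuantile_eq, div_eq_inv_mul p⁻¹, ← mul_inv]
  linarith

lemma cauchyQuantile_le {p c : ℝ} (hp : 0 < p) (hpc : p ≤ c) (hc : c < 1) :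
    cauchyQuantile p ≤ -(p⁻¹ / π) + tan (π * c / 2) := by
  have hπ := Real.pi_pos
  have h := inv_le_cos_div_sin_add_tan_half (mul_pos hπ hp)
    (mul_lt_of_lt_one_right hπ (hpc.trans_lt hc))
  have hp' : 0 < π * p := mul_pos hπ hp
  have hle : π * p ≤ π * c := mul_le_mul_of_nonneg_left hpc hπ.le
  have hlt : π * c < π := mul_lt_of_lt_one_right hπ hc
  have hmono : tan (π * p / 2) ≤ tan (π * c / 2) :=
    Real.strictMonoOn_tan.monotoneOn ⟨by linarith, by linarith⟩ ⟨by linarith, by linarith⟩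
      (by linarith)
  rw [cauchyQuantile_eq, div_eq_inv_mul p⁻¹, ← mul_inv]
  linarith

lemma cauchyCdf_neg {x : ℝ} (hx : 0 < x) : cauchyCdf (-x) = arctan x⁻¹ / π := by
  rw [cauchyCdf, Real.arctan_neg, Real.arctan_inv_of_pos hx]
  field_simp
  ring

lemma arctan_inv_le {x : ℝ} (hx : 0 < x) : arctan x⁻¹ ≤ x⁻¹ := by
  have h : 0 < x⁻¹ := inv_pos.2 hx
  simpa [Real.tan_arctan] using
    Real.le_tan (Real.arctan_nonneg.2 h.le) (Real.arctan_lt_pi_div_two x⁻¹)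

lemma inv_add_one_le_arctan_inv {x : ℝ} (hx : 0 < x) : (x + 1)⁻¹ ≤ arctan x⁻¹ := by
  have h : 0 < x⁻¹ := inv_pos.2 hx
  have hs := Real.sin_le (Real.arctan_nonneg.2 h.le)
  rw [Real.sin_arctan] at hs
  refine le_trans ?_ hs
  have hsq : √(1 + x⁻¹ ^ 2) ≤ 1 + x⁻¹ := by
    rw [Real.sqrt_le_left (by positivity)]
    nlinarith
  calc (x + 1)⁻¹ = x⁻¹ / (1 + x⁻¹) := by field_simp
    _ ≤ x⁻¹ / √(1 + x⁻¹ ^ 2) := by gcongr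

/-- If `x` lies within `B` below `H` and `H` is large, then `H * arctan x⁻¹` is close to `1`. -/
lemma abs_mul_arctan_inv_sub_one_lt {H x B δ : ℝ} (hB : 0 ≤ B) (hδ : 0 < δ)
    (hH : B + (B + 1) / δ < H) (h1 : H - B ≤ x) (h2 : x ≤ H) :
    |H * arctan x⁻¹ - 1| < δ := by
  have hd : 0 < (B + 1) / δ := by positivity
  have hx : 0 < x := by linarith
  have hH0 : 0 < H := hx.trans_le h2
  have hBx : B + 1 < δ * x := by
    rw [← div_lt_iff₀' hδ]
    linarith
  rw [abs_lt]
  constructor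
  · have h : H * (x + 1)⁻¹ ≤ H * arctan x⁻¹ :=
      mul_le_mul_of_nonneg_left (inv_add_one_le_arctan_inv hx) hH0.le
    have : 1 - δ < H * (x + 1)⁻¹ := by
      rw [← div_eq_mul_inv, lt_div_iff₀ (by linarith)]
      nlinarith
    linarith
  · have h : H * arctan x⁻¹ ≤ H * x⁻¹ := mul_le_mul_of_nonneg_left (arctan_inv_le hx) hH0.le
    have : H * x⁻¹ < 1 + δ := by
      rw [← div_eq_mul_inv, div_lt_iff₀ hx]
      nlinarith
    linarith

/-- `M_{C,K}(p)/M_{-1,K}(p) → 1` as `min_i p_i ↓ 0` subject to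
`max_i p_i ≤ c`. -/
theorem cauchy_harmonic_ratio_tendsto_one
    (K : ℕ) (hK : 2 ≤ K) (c : ℝ) (hc : c ∈ Set.Ioo (0:ℝ) 1) :
    ∀ δ : ℝ, 0 < δ → ∃ η : ℝ, 0 < η ∧
      ∀ p : Fin K → ℝ, (∀ i, p i ∈ Set.Ioo (0:ℝ) 1) →
        (∃ i, p i < η) → (∀ i, p i ≤ c) →
        |MCauchy K p / Mharm K p - 1| < δ := by
  intro δ hδ
  have hπ := Real.pi_pos
  have hK0 : (0 : ℝ) < K := by exact_mod_cast (by omega : 0 < K)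
  set B := tan (π * c / 2) with hBdef
  have hB : 0 ≤ B := Real.tan_nonneg_of_nonneg_of_le_pi_div_two
    (by have := hc.1; positivity) (by nlinarith [hc.2])
  have hT : 0 < B + (B + 1) / δ := by positivity
  refine ⟨(π * K * (B + (B + 1) / δ))⁻¹, by positivity, ?_⟩
  rintro p hp ⟨j, hj⟩ hpc
  set H := (∑ i, (p i)⁻¹) / (π * K) with hHdef
  set x := -((∑ i, cauchyQuantile (p i)) / (K : ℝ)) with hxdef
  have hH : B + (B + 1) / δ < H := by
    have hsum : (p j)⁻¹ ≤ ∑ i, (p i)⁻¹ :=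
      Finset.single_le_sum (f := fun i => (p i)⁻¹)
        (fun i _ => inv_nonneg.2 (hp i).1.le) (Finset.mem_univ j)
    have hj' := (lt_inv_comm₀ (hp j).1 (by positivity)).1 hj
    rw [hHdef, lt_div_iff₀' (by positivity)]
    exact hj'.trans_le hsum
  have hKH : K * H = ∑ i, (p i)⁻¹ / π := by
    rw [hHdef, ← Finset.sum_div]
    field_simp
  have hKx : K * x = -∑ i, cauchyQuantile (p i) := by
    rw [hxdef]
    field_simp
  have h1 : H - B ≤ x := by
    have h : ∑ i, cauchyQuantile (p i) ≤ ∑ i, (-((p i)⁻¹ / π) + B) :=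
      Finset.sum_le_sum fun i _ => cauchyQuantile_le (hp i).1 (hpc i) hc.2
    rw [Finset.sum_add_distrib, Finset.sum_neg_distrib, Finset.sum_const, Finset.card_univ,
      Fintype.card_fin, nsmul_eq_mul] at h
    refine le_of_mul_le_mul_left ?_ hK0
    linarith
  have h2 : x ≤ H := by
    have h : ∑ i, -((p i)⁻¹ / π) ≤ ∑ i, cauchyQuantile (p i) :=
      Finset.sum_le_sum fun i _ => neg_inv_le_cauchyQuantile (hp i)
    rw [Finset.sum_neg_distrib] at h
    refine le_of_mul_le_mul_left ?_ hK0
    linarith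
  have hd : 0 < (B + 1) / δ := by positivity
  have hx : 0 < x := by linarith
  have hratio : MCauchy K p / Mharm K p = H * arctan x⁻¹ := by
    have hC : MCauchy K p = arctan x⁻¹ / π := by
      rw [← cauchyCdf_neg hx, hxdef, neg_neg, MCauchy]
    rw [hC, Mharm, hHdef, div_div_eq_mul_div]
    field_simp
  rw [hratio]
  exact abs_mul_arctan_inv_sub_one_lt hB hδ hH h1 h2
end
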